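/- For all integers m, n, t > 0 and all integers a, b with 0 ≤ b ≤ a ≤ n−t, the number of paths P ∈ D(m,n,t) with val(P) = a and ret(P) = b equals C(n−t, a)·C(mn−b−1, a−b) − m·C(n−t+1, a+1)·C(mn−b−2, a−b−1), as an identity of integers. -/

import Mathlib

/-- A step of a lattice path: north `(0,1)`, east `(1,0)` or diagonal `(1,1)`. -/
inductive Step : Type
  | N : Step
  | E : Step
  | D : Step
  deriving DecidableEq

/-- The displacement vector of a step. -/
def stepVec : Step → ℤ × ℤ
  | .N => (0, 1)
  | .E => (1, 0)
  | .D => (1, 1)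

/-- The lattice point reached after the first `k` steps of the path `P` (starting at the
origin). -/
def pt (P : List Step) (k : ℕ) : ℤ × ℤ := ((P.take k).map stepVec).sum

/-- The path `P` starts with at least `t` north steps. -/
def StartsNorth (t : ℤ) (P : List Step) : Prop := List.replicate t.toNat Step.N <+: P

/-- The path `P` stays weakly above the line `x = m·y`. -/
def AboveLine (m : ℤ) (P : List Step) : Prop := ∀ k : ℕ, (pt P k).1 ≤ m * (pt P k).2

/-- An `(m,t)`-Schröder path of height `n`: a lattice path from `(0,0)` to `(mn,n)` using
north, east and diagonal steps, starting with at least `t` north steps and never going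
below the line `x = m·y`. -/
def IsSchroeder (m n t : ℤ) (P : List Step) : Prop :=
  StartsNorth t P ∧ pt P P.length = (m * n, n) ∧ AboveLine m P

/-- An `(m,t)`-Dyck path of height `n`: an `(m,t)`-Schröder path of height `n` with no
diagonal steps. -/
def IsDyck (m n t : ℤ) (P : List Step) : Prop :=
  IsSchroeder m n t P ∧ ∀ s ∈ P, s ≠ Step.D

/-- A Schröder path is small if none of its diagonal steps starts on the line `x = m·y`. -/
def IsSmall (m : ℤ) (P : List Step) : Prop :=
  ∀ j : ℕ, P[j]? = some Step.D → (pt P j).1 ≠ m * (pt P j).2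

/-- A Schröder path is positive if it touches the line `x = m·y` only at its two
endpoints. -/
def IsPositive (m : ℤ) (P : List Step) : Prop :=
  ∀ k : ℕ, 0 < k → k < P.length → (pt P k).1 ≠ m * (pt P k).2

/-- The set of indices `j` such that the `j`-th step of `P` is east and the `(j+1)`-st is
north; the corresponding valley point is `pt P (j+1)`. -/
def valleys (P : List Step) : Finset ℕ :=
  (Finset.range P.length).filter fun j => P[j]? = some Step.E ∧ P[j + 1]? = some Step.N

/-- The number of valleys of `P`. -/
def val (P : List Step) : ℕ := (valleys P).card

/-- The number of valleys of `P` whose `x`-coordinate is congruent to `i` modulo `m`. -/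
def ival (m i : ℤ) (P : List Step) : ℕ :=
  ((valleys P).filter fun j => (pt P (j + 1)).1 % m = i % m).card

/-- The set of returns of `P`: valleys of the form `(m·i, i)`. -/
def returns (m : ℤ) (P : List Step) : Finset ℕ :=
  (valleys P).filter fun j => (pt P (j + 1)).1 = m * (pt P (j + 1)).2

/-- The number of returns of `P`. -/
def ret (m : ℤ) (P : List Step) : ℕ := (returns m P).card

/-- The set of indices of diagonal steps of `P`. -/
def diags (P : List Step) : Finset ℕ :=
  (Finset.range P.length).filter fun j => P[j]? = some Step.D

/-- The number of diagonal steps of `P`. -/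
def dg (P : List Step) : ℕ := (diags P).card

/-- A Schröder path is `m`-divisible if every diagonal step ends at an `x`-coordinate
divisible by `m`. -/
def MDivisible (m : ℤ) (P : List Step) : Prop :=
  ∀ j ∈ diags P, m ∣ (pt P (j + 1)).1

/-- The number of cornered diagonal steps of `P`: diagonal steps connecting `(i·m − 1, i)`
to `(i·m, i + 1)` for some `i`. -/
def cd (m : ℤ) (P : List Step) : ℕ :=
  ((diags P).filter fun j => (pt P (j + 1)).1 = m * ((pt P (j + 1)).2 - 1)).card

/-- The generalized binomial coefficient `C(p,q) = p(p−1)⋯(p−q+1)/q!` for integers `p` and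
`q ≥ 0`, and `C(p,q) = 0` for `q < 0`. -/
def C (p q : ℤ) : ℤ :=
  if q < 0 then 0
  else if 0 ≤ p then (p.toNat.choose q.toNat : ℤ)
  else (-1) ^ q.toNat * ((q - p - 1).toNat.choose q.toNat : ℤ)

theorem C_of_neg {p q : ℤ} (hq : q < 0) : C p q = 0 := by
  simp [C, hq]

theorem C_natCast (p q : ℕ) : C p q = p.choose q := by
  simp [C]

theorem C_eq_ringChoose (p : ℤ) (q : ℕ) : C p q = Ring.choose p q := by
  rcases le_or_gt 0 p with hp | hp
  · lift p to ℕ using hp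
    rw [C_natCast, Ring.choose_natCast]
  · obtain ⟨r, rfl⟩ : ∃ r : ℕ, p = -((r : ℤ) + 1) := ⟨(-p - 1).toNat, by omega⟩
    rw [Ring.choose_neg, C, if_neg (by omega), if_neg (by omega), Int.toNat_natCast]
    have h : ((r : ℤ) + 1 + q - 1) = ((r + q : ℕ) : ℤ) := by push_cast; ring
    rw [h, Ring.choose_natCast, Units.smul_def, smul_eq_mul]
    have h' : ((q : ℤ) - -((r : ℤ) + 1) - 1).toNat = r + q := by omega
    rw [h']
    simp [Int.negOnePow]

theorem C_zero_right (p : ℤ) : C p 0 = 1 := by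
  simpa using C_eq_ringChoose p 0

/-- Pascal's rule holds for all integer arguments. -/
theorem C_pascal (p q : ℤ) : C p q = C (p - 1) q + C (p - 1) (q - 1) := by
  rcases lt_trichotomy q 0 with hq | rfl | hq
  · simp [C_of_neg hq, C_of_neg (show q - 1 < 0 by omega)]
  · rw [C_zero_right, C_zero_right, C_of_neg (by norm_num), add_zero]
  · obtain ⟨k, rfl⟩ : ∃ k : ℕ, q = ((k + 1 : ℕ) : ℤ) := ⟨(q - 1).toNat, by omega⟩
    have h : ((k + 1 : ℕ) : ℤ) - 1 = k := by push_cast; ring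
    have := Ring.choose_succ_succ (p - 1) k
    rw [sub_add_cancel] at this
    rw [h, C_eq_ringChoose, C_eq_ringChoose, C_eq_ringChoose, this, add_comm]

theorem mul_C {p q : ℤ} (hp : 0 < p) (hq : 0 < q) : q * C p q = p * C (p - 1) (q - 1) := by
  obtain ⟨p, rfl⟩ : ∃ k : ℕ, p = ((k + 1 : ℕ) : ℤ) := ⟨(p - 1).toNat, by omega⟩
  obtain ⟨q, rfl⟩ : ∃ k : ℕ, q = ((k + 1 : ℕ) : ℤ) := ⟨(q - 1).toNat, by omega⟩
  have h (k : ℕ) : ((k + 1 : ℕ) : ℤ) - 1 = k := by push_cast; ring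
  rw [h, h, C_natCast, C_natCast]
  have := Nat.add_one_mul_choose_eq p q
  rw [mul_comm]
  exact_mod_cast this.symm

/-- The number of pairs of sequences `h ≥ u₁ > ⋯ > u_a ≥ 1`, `w ≥ v₁ > ⋯ > v_a ≥ 1` such that
`m * uᵢ ≤ vᵢ` for all `i`, with equality for exactly `b` indices, when `m * h ≤ w`. -/
def valleyCount (m a b w h : ℤ) : ℤ :=
  C h a * C (w - b) (a - b) - m * C (h + 1) (a + 1) * C (w - b - 1) (a - b - 1)

theorem valleyCount_of_neg (m : ℤ) {b : ℤ} (w h : ℤ) (hb : -1 ≤ b) :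
    valleyCount m (-1) b w h = 0 := by
  simp [valleyCount, C_of_neg (show (-1 : ℤ) < 0 by norm_num),
    C_of_neg (show -1 - b - 1 < 0 by omega)]

theorem valleyCount_zero (m w : ℤ) {a b : ℤ} (ha : 0 ≤ a) (hb : 0 ≤ b) :
    valleyCount m a b w 0 = if a = 0 ∧ b = 0 then 1 else 0 := by
  rcases ha.eq_or_lt with rfl | ha
  · rcases hb.eq_or_lt with rfl | hb
    · simp [valleyCount, C_zero_right, C_of_neg (show (-1 : ℤ) < 0 by norm_num)]
    · simp [valleyCount, C_of_neg (show -b < 0 by omega), C_of_neg (show -b - 1 < 0 by omega),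
        hb.ne']
  · lift a to ℕ using ha.le
    have h0 : C 0 a = 0 := by
      have := C_natCast 0 a
      rw [Nat.choose_eq_zero_of_lt (by omega)] at this
      exact_mod_cast this
    have h1 : C 1 (a + 1) = 0 := by
      have := C_natCast 1 (a + 1)
      rw [Nat.choose_eq_zero_of_lt (by omega)] at this
      exact_mod_cast this
    rw [if_neg (by omega)]
    simp [valleyCount, h0, h1]

theorem valleyCount_interior (m a b w h : ℤ) :
    valleyCount m a b w h - valleyCount m a b w (h - 1) =
      valleyCount m (a - 1) b (w - 1) (h - 1) +
        (valleyCount m a b (w - 1) h - valleyCount m a b (w - 1) (h - 1)) := by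
  have h1 := C_pascal h a
  have h2 := C_pascal (h + 1) (a + 1)
  have h3 := C_pascal (w - b) (a - b)
  have h4 := C_pascal (w - b - 1) (a - b - 1)
  simp only [valleyCount, sub_add_cancel, add_sub_cancel_right] at *
  rw [show w - 1 - b = w - b - 1 by ring, show a - 1 - b = a - b - 1 by ring, h2, h1, h3, h4]
  ring

theorem valleyCount_boundary (m a b h : ℤ) :
    valleyCount m a b (m * h) h - valleyCount m a b (m * h) (h - 1) =
      valleyCount m (a - 1) (b - 1) (m * h - 1) (h - 1) := by
  have h1 := C_pascal h a
  have h2 := C_pascal (h + 1) (a + 1)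
  simp only [valleyCount, sub_add_cancel, add_sub_cancel_right] at *
  rw [show m * h - 1 - (b - 1) = m * h - b by ring, show a - 1 - (b - 1) = a - b by ring, h2, h1]
  ring

theorem valleyCount_boundary_neg_one {m a h : ℤ} (hm : 0 < m) (hh : 0 < h) (ha : 0 ≤ a) :
    valleyCount m (a - 1) (-1) (m * h - 1) (h - 1) = 0 := by
  rcases ha.eq_or_lt with rfl | ha
  · exact valleyCount_of_neg _ _ _ le_rfl
  · have h1 := mul_C hh ha
    have h2 := mul_C (mul_pos hm hh) ha
    simp only [valleyCount, sub_add_cancel, sub_neg_eq_add]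
    refine (mul_eq_zero.mp (?_ : a * _ = 0)).resolve_left ha.ne'
    linear_combination C (h - 1) (a - 1) * h2 - m * C (m * h - 1) (a - 1) * h1

/-- `IsSuffix m p e h a b L` says that `L` consists of `e` east and `h` north steps and is the
remaining part of a path that stays above the line, where `p` records whether the previous step
was east, such that `L` creates `a` further valleys, `b` of them returns. -/
def IsSuffix (m : ℤ) : Bool → ℤ → ℤ → ℤ → ℤ → List Step → Prop
  | _, e, h, a, b, [] => e = 0 ∧ h = 0 ∧ a = 0 ∧ b = 0
  | false, e, h, a, b, .N :: L => IsSuffix m false e (h - 1) a b L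
  | true, e, h, a, b, .N :: L =>
    IsSuffix m false e (h - 1) (a - 1) (if e = m * h then b - 1 else b) L
  | _, e, h, a, b, .E :: L => m * h ≤ e - 1 ∧ IsSuffix m true (e - 1) h a b L
  | _, _, _, _, _, .D :: _ => False

theorem IsSuffix.nonneg {m e h a b : ℤ} {p : Bool} {L : List Step}
    (H : IsSuffix m p e h a b L) : 0 ≤ e ∧ 0 ≤ h ∧ 0 ≤ a ∧ 0 ≤ b := by
  induction L generalizing p e h a b with
  | nil => simp only [IsSuffix] at H; omega
  | cons s L ih =>
    cases s <;> cases p <;> simp only [IsSuffix] at H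
    · have := ih H; omega
    · have := ih H; split_ifs at this <;> omega
    · have := ih H.2; omega
    · have := ih H.2; omega

/-- `s` is finite and has `z` elements. -/
def HasCard (s : Set (List Step)) (z : ℤ) : Prop := s.Finite ∧ (s.ncard : ℤ) = z

theorem hasCard_of_forall {s : Set (List Step)} (hs : ∀ L, L ∉ s) : HasCard s 0 := by
  rw [Set.eq_empty_of_forall_notMem hs]
  simp [HasCard]

theorem HasCard.union_cons {s u v : Set (List Step)} {x y : ℤ} (hu : HasCard u x)
    (hv : HasCard v y) (nil_notMem : [] ∉ s) (hN : ∀ L, Step.N :: L ∈ s ↔ L ∈ u)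
    (hE : ∀ L, Step.E :: L ∈ s ↔ L ∈ v) (hD : ∀ L, Step.D :: L ∉ s) :
    HasCard s (x + y) := by
  have hs : s = List.cons Step.N '' u ∪ List.cons Step.E '' v := by
    ext (_ | ⟨_ | _ | _, L⟩) <;> simp [*]
  have hdis : Disjoint (List.cons Step.N '' u) (List.cons Step.E '' v) := by
    rw [Set.disjoint_left]
    rintro _ ⟨L, _, rfl⟩ ⟨L', _, h⟩
    simp at h
  refine ⟨hs ▸ (hu.1.image _).union (hv.1.image _), ?_⟩
  rw [hs, Set.ncard_union_eq hdis (hu.1.image _) (hv.1.image _),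
    Set.ncard_image_of_injective _ List.cons_injective,
    Set.ncard_image_of_injective _ List.cons_injective, Nat.cast_add, hu.2, hv.2]

theorem hasCard_isSuffix {m : ℤ} (hm : 0 < m) (k : ℕ) {e h a b : ℤ} (he : 0 ≤ e) (hh : 0 ≤ h)
    (ha : 0 ≤ a) (hb : 0 ≤ b) (hk : e + h = k) :
    (m * (h + 1) ≤ e →
      HasCard {L | IsSuffix m false e h a b L} (valleyCount m a b (e - 1) h)) ∧
    (m * h ≤ e → HasCard {L | IsSuffix m true e h a b L}
      (valleyCount m a b e h - if h = 0 then 0 else valleyCount m a b e (h - 1))) := by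
  induction k generalizing e h a b with
  | zero =>
    obtain rfl : e = 0 := by omega
    obtain rfl : h = 0 := by omega
    refine ⟨fun H => by omega, fun _ => ?_⟩
    rw [valleyCount_zero _ _ ha hb, if_pos rfl, sub_zero]
    have key : ∀ L, IsSuffix m true 0 0 a b L ↔ L = [] ∧ a = 0 ∧ b = 0 := by
      rintro (_ | ⟨_ | _ | _, L⟩)
      · simp [IsSuffix]
      · simp only [IsSuffix]
        exact ⟨fun H => absurd H.nonneg.2.1 (by norm_num), by simp⟩
      · simp [IsSuffix]
      · simp [IsSuffix]
    simp only [key]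
    split_ifs with hab
    · simp [hab, HasCard]
    · exact hasCard_of_forall (by simp [hab])
  | succ k ih =>
    have hnil (p : Bool) : [] ∉ {L | IsSuffix m p e h a b L} := by
      simp only [Set.mem_ofPred_eq, IsSuffix]; omega
    constructor
    · intro H
      have hE : m * h ≤ e - 1 := by linarith
      have he1 : 0 ≤ e - 1 := by nlinarith
      have cE := (ih he1 hh ha hb (by omega)).2 hE
      have hN : HasCard {L | IsSuffix m false e (h - 1) a b L}
          (if h = 0 then 0 else valleyCount m a b (e - 1) (h - 1)) := by
        split_ifs with h0
        · exact hasCard_of_forall fun L HL => absurd HL.nonneg.2.1 (by omega)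
        · exact (ih he (by omega) ha hb (by omega)).1 (by rw [sub_add_cancel]; linarith)
      have := hN.union_cons cE (hnil false) (by simp [IsSuffix]) (by simp [IsSuffix, hE])
        (by simp [IsSuffix])
      rwa [add_sub_cancel] at this
    · intro H
      have hN : HasCard
          {L | IsSuffix m false e (h - 1) (a - 1) (if e = m * h then b - 1 else b) L}
          (if h = 0 then 0 else
            valleyCount m (a - 1) (if e = m * h then b - 1 else b) (e - 1) (h - 1)) := by
        by_cases h0 : h = 0
        · rw [if_pos h0]
          exact hasCard_of_forall fun L HL => absurd (IsSuffix.nonneg HL).2.1 (by omega)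
        rw [if_neg h0]
        rcases ha.eq_or_lt with rfl | ha'
        · rw [zero_sub, valleyCount_of_neg _ _ _ (by split_ifs <;> omega)]
          exact hasCard_of_forall fun L HL => absurd (IsSuffix.nonneg HL).2.2.1 (by omega)
        by_cases hb' : 0 ≤ if e = m * h then b - 1 else b
        · exact (ih he (by omega) (by omega) hb' (by omega)).1 (by rwa [sub_add_cancel])
        · have h1 : e = m * h := by by_contra h1; rw [if_neg h1] at hb'; exact hb' hb
          rw [if_pos h1] at hb' ⊢
          obtain rfl : b = 0 := by omega
          rw [zero_sub, h1, valleyCount_boundary_neg_one hm (by omega) ha]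
          exact hasCard_of_forall fun L HL => absurd (IsSuffix.nonneg HL).2.2.2 (by omega)
      rcases H.eq_or_lt with rfl | hE
      · have cE : HasCard ∅ 0 := hasCard_of_forall (by simp)
        have := hN.union_cons cE (hnil true) (by simp [IsSuffix]) (by simp [IsSuffix])
          (by simp [IsSuffix])
        have h0 : h ≠ 0 := by rintro rfl; simp at hk; omega
        rw [if_neg h0] at this ⊢
        rwa [if_pos rfl, add_zero, ← valleyCount_boundary] at this
      · have hE1 : m * h ≤ e - 1 := by omega
        have he1 : 0 ≤ e - 1 := by nlinarith
        have cE := (ih he1 hh ha hb (by omega)).2 hE1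
        have := hN.union_cons cE (hnil true) (by simp [IsSuffix]) (by simp [IsSuffix, hE1])
          (by simp [IsSuffix])
        rw [if_neg hE.ne'] at this
        split_ifs at this ⊢ with h0
        · subst h0
          rwa [valleyCount_zero _ _ ha hb, zero_add, ← valleyCount_zero m e ha hb] at this
        · rwa [valleyCount_interior]

theorem isSuffix_replicate_append (m e h a b : ℤ) (t : ℕ) (L : List Step) :
    IsSuffix m false e h a b (List.replicate t .N ++ L) ↔ IsSuffix m false e (h - t) a b L := by
  induction t generalizing h with
  | zero => simp
  | succ t ih =>
    rw [List.replicate_succ, List.cons_append, IsSuffix, ih]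
    congr! 1
    push_cast
    ring

theorem pt_zero (L : List Step) : pt L 0 = 0 := by
  simp [pt]

theorem pt_cons_succ (s : Step) (L : List Step) (k : ℕ) :
    pt (s :: L) (k + 1) = stepVec s + pt L k := by
  simp [pt]

theorem card_filter_valleys_cons (s : Step) (L : List Step) (q : ℕ → Prop) [DecidablePred q] :
    ((valleys (s :: L)).filter q).card =
      ((valleys L).filter fun j => q (j + 1)).card +
        if s = .E ∧ L[0]? = some .N ∧ q 0 then 1 else 0 := by
  simp only [valleys, Finset.filter_filter, Finset.card_filter, List.length_cons,
    Finset.sum_range_succ', List.getElem?_cons_succ, List.getElem?_cons_zero, Option.some.injEq, and_assoc]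

theorem val_cons (s : Step) (L : List Step) :
    val (s :: L) = val L + if s = .E ∧ L[0]? = some .N then 1 else 0 := by
  simpa [val] using card_filter_valleys_cons s L fun _ => True

/-- The number of valleys of `P` on the line `x = m * y + c`. -/
def valOn (m c : ℤ) (P : List Step) : ℕ :=
  ((valleys P).filter fun j => (pt P (j + 1)).1 = m * (pt P (j + 1)).2 + c).card

theorem valOn_zero (m : ℤ) (P : List Step) : valOn m 0 P = ret m P := by
  simp [valOn, ret, returns]

theorem valOn_cons (m c : ℤ) (s : Step) (L : List Step) :
    valOn m c (s :: L) = valOn m (c + m * (stepVec s).2 - (stepVec s).1) L +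
      if s = .E ∧ L[0]? = some .N ∧ c = 1 then 1 else 0 := by
  rw [valOn, card_filter_valleys_cons, valOn]
  congr 1
  · refine congrArg _ (Finset.filter_congr fun j _ => ?_)
    rw [pt_cons_succ, Prod.fst_add, Prod.snd_add, mul_add]
    constructor <;> intro <;> linarith
  · congr! 1
    refine and_congr_right ?_
    rintro rfl
    simp [pt_cons_succ, pt_zero, stepVec, eq_comm]

/-- The path `P` stays weakly above the line `x = m * y + c`. -/
def AboveShifted (m c : ℤ) (P : List Step) : Prop := ∀ k : ℕ, (pt P k).1 ≤ m * (pt P k).2 + c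

theorem AboveShifted.nonneg {m c : ℤ} {P : List Step} (H : AboveShifted m c P) : 0 ≤ c := by
  simpa [pt_zero] using H 0

theorem aboveShifted_nil (m c : ℤ) : AboveShifted m c [] ↔ 0 ≤ c := by
  simp [AboveShifted, pt]

theorem aboveShifted_cons (m c : ℤ) (s : Step) (L : List Step) :
    AboveShifted m c (s :: L) ↔
      0 ≤ c ∧ AboveShifted m (c + m * (stepVec s).2 - (stepVec s).1) L := by
  refine ⟨fun H => ⟨H.nonneg, fun k => ?_⟩, fun H k => ?_⟩
  · have := H (k + 1)
    rw [pt_cons_succ, Prod.fst_add, Prod.snd_add, mul_add] at this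
    linarith
  · cases k with
    | zero => simpa [pt_zero] using H.1
    | succ k =>
      have := H.2 k
      rw [pt_cons_succ, Prod.fst_add, Prod.snd_add, mul_add]
      linarith

theorem isSuffix_iff {m : ℤ} (hm : 0 < m) (p : Bool) {e h : ℤ} (a b : ℤ) (L : List Step)
    (H : m * h ≤ e) :
    IsSuffix m p e h a b L ↔
      (∀ s ∈ L, s ≠ .D) ∧ pt L L.length = (e, h) ∧ AboveShifted m (e - m * h) L ∧
        (val L : ℤ) + (if p ∧ L[0]? = some .N then 1 else 0) = a ∧
        (valOn m (e - m * h) L : ℤ) + (if p ∧ L[0]? = some .N ∧ e = m * h then 1 else 0) = b := by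
  induction L generalizing p e h a b with
  | nil =>
    have h0 : AboveShifted m (e - m * h) [] := (aboveShifted_nil _ _).2 (by linarith)
    simp [IsSuffix, pt, val, valOn, valleys, h0, Prod.ext_iff, eq_comm, and_assoc]
  | cons s L ih =>
    have hnn : 0 ≤ e - m * h := by linarith
    simp only [List.length_cons, pt_cons_succ, aboveShifted_cons, val_cons, valOn_cons,
      List.forall_mem_cons, List.getElem?_cons_zero]
    cases s
    · have hpt : stepVec .N + pt L L.length = (e, h) ↔ pt L L.length = (e, h - 1) := by
        simp only [stepVec, Prod.ext_iff, Prod.fst_add, Prod.snd_add]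
        omega
      have hc : e - m * h + m * (stepVec .N).2 - (stepVec .N).1 = e - m * (h - 1) := by
        simp only [stepVec]; ring
      rw [hpt, hc]
      cases p
      · simp only [IsSuffix]
        rw [ih _ _ _ (by linarith)]
        simp [H]
      · simp only [IsSuffix]
        rw [ih _ _ _ (by linarith)]
        simp only [ne_eq, reduceCtorEq, not_false_eq_true, true_and, hnn, false_and, if_false,
          Bool.false_eq_true]
        have ha : (val L : ℤ) = a - 1 ↔ (val L : ℤ) + 1 = a := by omega
        have hb (x : ℤ) : x = (if e = m * h then b - 1 else b) ↔
            x + (if e = m * h then 1 else 0) = b := by split_ifs <;> omega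
        simp [ha, hb]
    · have hpt : stepVec .E + pt L L.length = (e, h) ↔ pt L L.length = (e - 1, h) := by
        simp only [stepVec, Prod.ext_iff, Prod.fst_add, Prod.snd_add]
        omega
      have hc : e - m * h + m * (stepVec .E).2 - (stepVec .E).1 = e - 1 - m * h := by
        simp only [stepVec]; ring
      have h1 : e - m * h = 1 ↔ e - 1 = m * h := by omega
      simp only [hpt, hc, h1]
      rw [show IsSuffix m p e h a b (.E :: L) ↔
        m * h ≤ e - 1 ∧ IsSuffix m true (e - 1) h a b L by cases p <;> simp only [IsSuffix]]
      by_cases hE : m * h ≤ e - 1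
      · rw [ih _ _ _ hE]
        simp [hE, H]
      · have : ¬ AboveShifted m (e - 1 - m * h) L := fun A => by
          have := A.nonneg
          omega
        simp [hE, this]
    · cases p <;> simp [IsSuffix]

/-- the number of `(m,t)`-Dyck paths of height `n` with `a` valleys and `b`
returns. -/
theorem statement1 (m n t a b : ℤ) (hm : 0 < m) (hn : 0 < n) (ht : 0 < t)
    (hb : 0 ≤ b) (hba : b ≤ a) (ha : a ≤ n - t) :
    (({P : List Step | IsDyck m n t P ∧ (val P : ℤ) = a ∧ (ret m P : ℤ) = b}.ncard : ℤ))
      = C (n - t) a * C (m * n - b - 1) (a - b)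
        - m * C (n - t + 1) (a + 1) * C (m * n - b - 2) (a - b - 1) := by
  obtain ⟨t, rfl⟩ : ∃ k : ℕ, t = k := ⟨t.toNat, by omega⟩
  have hset : {P : List Step | IsDyck m n t P ∧ (val P : ℤ) = a ∧ (ret m P : ℤ) = b} =
      (List.replicate t .N ++ ·) '' {L | IsSuffix m false (m * n) (n - t) a b L} := by
    ext P
    have key := isSuffix_iff hm false a b P (le_refl (m * n))
    simp only [sub_self, valOn_zero, Bool.false_eq_true, false_and, if_false, add_zero] at key
    have habove : AboveShifted m 0 P ↔ AboveLine m P := by simp [AboveShifted, AboveLine]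
    rw [habove] at key
    simp only [Set.mem_ofPred_eq, Set.mem_image, IsDyck, IsSchroeder, StartsNorth,
      Int.toNat_natCast, ← isSuffix_replicate_append]
    constructor
    · rintro ⟨⟨⟨⟨L, rfl⟩, h1, h2⟩, h3⟩, h4, h5⟩
      exact ⟨L, key.2 ⟨h3, h1, h2, h4, h5⟩, rfl⟩
    · rintro ⟨L, hL, rfl⟩
      obtain ⟨h3, h1, h2, h4, h5⟩ := key.1 hL
      exact ⟨⟨⟨⟨L, rfl⟩, h1, h2⟩, h3⟩, h4, h5⟩
  have hmn : 0 ≤ m * n := by positivity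
  have hcard := ((hasCard_isSuffix hm (m * n + (n - t)).toNat hmn (h := n - t) (by omega) (hb.trans hba) hb
    (by omega)).1 (by nlinarith)).2
  rw [hset, Set.ncard_image_of_injective _ (List.append_right_injective _), hcard, valleyCount]
  congr! 3 <;> ring
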